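/- (Theorem 1.3, variational form) For every continuous f : X → ℝ there exists a sequence (β_n) of positive real numbers with β_n → +∞ such that lim_{n→∞} P(−β_n a + f) = P_K(f), where P(g) := sup_{μ∈𝔐} ( h(μ) + ∫_X g dμ ) and P_K(f) := sup { h(μ) + ∫_X f dμ : μ ∈ 𝔐, μ(K) = 1 }. (Taking f = ½ log Jᵘ and h the Kolmogorov–Sinai entropy, this is the thermodynamic limit Pr(−β_n ā + ½ log Jᵘ) + β_n a₀ → Pr_K(½ log Jᵘ) of the paper, in the case a₀ = 0.) -/

import Mathlib

open MeasureTheory Filter Topology Set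

noncomputable section

/-- A continuous flow on `X`. -/
def IsFlow {X : Type*} [TopologicalSpace X] (Φ : ℝ → X → X) : Prop :=
  Continuous (fun p : ℝ × X => Φ p.1 p.2) ∧ Φ 0 = id ∧ ∀ t s : ℝ, Φ (t + s) = Φ t ∘ Φ s

/-- The set of flow-invariant Borel probability measures. -/
def Minv {X : Type*} [TopologicalSpace X] [MeasurableSpace X] (Φ : ℝ → X → X) :
    Set (ProbabilityMeasure X) :=
  {μ | ∀ t : ℝ, (μ : Measure X).map (Φ t) = (μ : Measure X)}

/-- The topological support of a measure. -/
def msupport {X : Type*} [TopologicalSpace X] [MeasurableSpace X] (μ : Measure X) : Set X :=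
  {x | ∀ U : Set X, IsOpen U → x ∈ U → 0 < μ U}

/-- The undamped set `K`: the closure of the union of the supports of all
minimizing invariant measures. -/
def Kset {X : Type*} [TopologicalSpace X] [MeasurableSpace X] (Φ : ℝ → X → X) (a : X → ℝ) :
    Set X :=
  closure (⋃ μ ∈ {μ ∈ Minv Φ | ∫ x, a x ∂(μ : Measure X) = 0}, msupport (μ : Measure X))

/-- Abstract pressure: `P(g) = sup over invariant measures of h(μ) + ∫ g dμ`. -/
def Pres {X : Type*} [TopologicalSpace X] [MeasurableSpace X] (Φ : ℝ → X → X)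
    (h : ProbabilityMeasure X → ℝ) (g : X → ℝ) : ℝ :=
  sSup {r : ℝ | ∃ μ ∈ Minv Φ, r = h μ + ∫ x, g x ∂(μ : Measure X)}

/-- Abstract pressure on `K`: sup over invariant measures with `μ(K) = 1`. -/
def PresK {X : Type*} [TopologicalSpace X] [MeasurableSpace X] (Φ : ℝ → X → X) (a : X → ℝ)
    (h : ProbabilityMeasure X → ℝ) (f : X → ℝ) : ℝ :=
  sSup {r : ℝ | ∃ μ ∈ Minv Φ,
    (μ : Measure X) (Kset Φ a) = 1 ∧ r = h μ + ∫ x, f x ∂(μ : Measure X)}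


lemma cont_integral {X : Type*} [MetricSpace X] [CompactSpace X] [MeasurableSpace X] [BorelSpace X]
    (f : X → ℝ) (hf : Continuous f) :
    Continuous fun μ : ProbabilityMeasure X => ∫ x, f x ∂(μ : Measure X) :=
  ProbabilityMeasure.continuous_integral_boundedContinuousFunction
    (BoundedContinuousFunction.mkOfCompact ⟨f, hf⟩)

lemma integrable_cont {X : Type*} [MetricSpace X] [CompactSpace X] [MeasurableSpace X]
    [BorelSpace X] (f : X → ℝ) (hf : Continuous f) (μ : ProbabilityMeasure X) :
    Integrable f (μ : Measure X) :=
  hf.integrable_of_hasCompactSupport (HasCompactSupport.of_compactSpace f)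

lemma isClosed_Minv {X : Type*} [MetricSpace X] [CompactSpace X] [MeasurableSpace X]
    [BorelSpace X] (Φ : ℝ → X → X) (hΦ : IsFlow Φ) : IsClosed (Minv Φ) := by
  have hc : ∀ t, Continuous (Φ t) := fun t =>
    hΦ.1.comp (Continuous.prodMk continuous_const continuous_id)
  have : Minv Φ = ⋂ t : ℝ, {μ : ProbabilityMeasure X | μ.map (hc t).aemeasurable = μ} := by
    ext μ
    simp only [Minv, mem_ofPred_eq, mem_iInter]
    refine forall_congr' fun t => ?_
    exact (Subtype.ext_iff (a1 := μ.map (hc t).aemeasurable) (a2 := μ)).symm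
  rw [this]
  refine isClosed_iInter fun t => isClosed_eq ?_ continuous_id
  exact ProbabilityMeasure.continuous_map (hc t)

lemma zero_on_K {X : Type*} [MetricSpace X] [CompactSpace X] [MeasurableSpace X]
    [BorelSpace X] (Φ : ℝ → X → X) (a : X → ℝ) (ha : Continuous a) (ha0 : ∀ x, 0 ≤ a x) :
    ∀ x ∈ Kset Φ a, a x = 0 := by
  have hcl : IsClosed {x | a x = 0} := isClosed_eq ha continuous_const
  have : Kset Φ a ⊆ {x | a x = 0} := by
    refine closure_minimal ?_ hcl
    refine iUnion₂_subset fun μ hμ x hx => ?_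
    by_contra hne
    have h1 := hx _ hcl.isOpen_compl hne
    have h2 := (integral_eq_zero_iff_of_nonneg ha0 (integrable_cont a ha μ)).1 hμ.2
    exact h1.ne' h2
  exact this

lemma minimizing_iff {X : Type*} [MetricSpace X] [CompactSpace X] [MeasurableSpace X]
    [BorelSpace X] (Φ : ℝ → X → X) (a : X → ℝ) (ha : Continuous a) (ha0 : ∀ x, 0 ≤ a x)
    (μ : ProbabilityMeasure X) (hμ : μ ∈ Minv Φ) :
    (μ : Measure X) (Kset Φ a) = 1 ↔ ∫ x, a x ∂(μ : Measure X) = 0 := by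
  have hm : MeasurableSet (Kset Φ a) := isClosed_closure.measurableSet
  rw [← mem_ae_iff_prob_eq_one hm]
  constructor
  · intro h
    refine integral_eq_zero_of_ae ?_
    filter_upwards [h] with x hx
    exact zero_on_K Φ a ha ha0 x hx
  · intro h
    filter_upwards [Measure.support_mem_ae (μ := (μ : Measure X))] with x hx
    refine subset_closure ?_
    refine mem_biUnion (x := μ) ⟨hμ, h⟩ ?_
    intro U hU hxU
    exact (Measure.mem_support_iff_forall x).1 hx U (hU.mem_nhds hxU)

/-- Theorem 1.3, variational form: there is a sequence `βₙ → ∞` along which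
`P(-βₙ a + f) → P_K(f)`. -/
theorem stmt9 {X : Type*} [MetricSpace X] [CompactSpace X] [MeasurableSpace X] [BorelSpace X]
    (Φ : ℝ → X → X) (hΦ : IsFlow Φ)
    (a : X → ℝ) (ha : Continuous a) (ha0 : ∀ x, 0 ≤ a x)
    (hmin : ∃ μ ∈ Minv Φ, ∫ x, a x ∂(μ : Measure X) = 0)
    (h : ProbabilityMeasure X → ℝ)
    (hbd : ∃ C : ℝ, ∀ μ ∈ Minv Φ, |h μ| ≤ C)
    (husc : UpperSemicontinuousOn h (Minv Φ))
    (f : X → ℝ) (hf : Continuous f) :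
    ∃ β : ℕ → ℝ, (∀ n, 0 < β n) ∧ Tendsto β atTop atTop ∧
      Tendsto (fun n => Pres Φ h (fun x => -β n * a x + f x)) atTop
        (𝓝 (PresK Φ a h f)) := by
  obtain ⟨C, hC⟩ := hbd
  obtain ⟨μ₀, hμ₀, hμ₀a⟩ := hmin
  obtain ⟨F, hF⟩ : ∃ F : ℝ, ∀ x, f x ≤ F := by
    obtain ⟨F, hF⟩ := (isCompact_range hf).bddAbove
    exact ⟨F, fun x => hF ⟨x, rfl⟩⟩
  have hfF : ∀ μ : ProbabilityMeasure X, ∫ x, f x ∂(μ : Measure X) ≤ F := fun μ => by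
    calc ∫ x, f x ∂(μ : Measure X) ≤ ∫ _, F ∂(μ : Measure X) :=
          integral_mono (integrable_cont f hf μ) (integrable_const F) hF
      _ = F := by simp
  have ha_nn : ∀ μ : ProbabilityMeasure X, 0 ≤ ∫ x, a x ∂(μ : Measure X) :=
    fun μ => integral_nonneg ha0
  have hsplit : ∀ (b : ℝ) (μ : ProbabilityMeasure X),
      ∫ x, (-b * a x + f x) ∂(μ : Measure X)
        = -b * ∫ x, a x ∂(μ : Measure X) + ∫ x, f x ∂(μ : Measure X) := fun b μ => by
    rw [integral_add ((integrable_cont a ha μ).const_mul _) (integrable_cont f hf μ),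
      integral_const_mul]
  have hub : ∀ μ ∈ Minv Φ, h μ + ∫ x, f x ∂(μ : Measure X) ≤ C + F := fun μ hμ =>
    add_le_add ((le_abs_self _).trans (hC μ hμ)) (hfF μ)
  have hPKle : ∀ μ ∈ Minv Φ, ∫ x, a x ∂(μ : Measure X) = 0 →
      h μ + ∫ x, f x ∂(μ : Measure X) ≤ PresK Φ a h f := fun μ hμ hμa => by
    refine le_csSup ⟨C + F, ?_⟩ ⟨μ, hμ, (minimizing_iff Φ a ha ha0 μ hμ).2 hμa, rfl⟩
    rintro r ⟨ν, hν, -, rfl⟩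
    exact hub ν hν
  have hlow : ∀ b : ℝ, 0 ≤ b → PresK Φ a h f ≤ Pres Φ h (fun x => -b * a x + f x) := by
    intro b hb
    refine csSup_le ⟨_, μ₀, hμ₀, (minimizing_iff Φ a ha ha0 μ₀ hμ₀).2 hμ₀a, rfl⟩ ?_
    rintro r ⟨ν, hν, hνK, rfl⟩
    refine le_csSup ⟨C + F, ?_⟩ ⟨ν, hν, ?_⟩
    · rintro r ⟨ρ, hρ, rfl⟩
      rw [hsplit]
      nlinarith [hub ρ hρ, mul_nonneg hb (ha_nn ρ)]
    · rw [hsplit, (minimizing_iff Φ a ha ha0 ν hν).1 hνK]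
      ring
  have hup : ∀ c : ℝ, PresK Φ a h f < c → ∃ B : ℝ, ∀ b ≥ B, ∀ μ ∈ Minv Φ,
      h μ + ∫ x, (-b * a x + f x) ∂(μ : Measure X) ≤ c := by
    intro c hc
    refine (isClosed_Minv Φ hΦ).isCompact.induction_on
      (p := fun s => ∃ B : ℝ, ∀ b ≥ B, ∀ μ ∈ s,
        h μ + ∫ x, (-b * a x + f x) ∂(μ : Measure X) ≤ c) ⟨0, by simp⟩ ?_ ?_ ?_
    · rintro s t hst ⟨B, hB⟩
      exact ⟨B, fun b hb μ hμ => hB b hb μ (hst hμ)⟩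
    · rintro s t ⟨B, hB⟩ ⟨B', hB'⟩
      refine ⟨max B B', fun b hb μ hμ => ?_⟩
      rcases hμ with hμ | hμ
      · exact hB b ((le_max_left _ _).trans hb) μ hμ
      · exact hB' b ((le_max_right _ _).trans hb) μ hμ
    · intro μ hμ
      by_cases hμa : ∫ x, a x ∂(μ : Measure X) = 0
      · have h1 := hPKle μ hμ hμa
        set δ := (c - PresK Φ a h f) / 2 with hδ
        have hδ0 : 0 < δ := by rw [hδ]; linarith
        have e1 : ∀ᶠ ν in 𝓝[Minv Φ] μ, h ν < h μ + δ :=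
          (upperSemicontinuousOn_iff.1 husc) μ hμ _ (by linarith)
        have e2 : ∀ᶠ ν : ProbabilityMeasure X in 𝓝[Minv Φ] μ,
            ∫ x, f x ∂(ν : Measure X) < ∫ x, f x ∂(μ : Measure X) + δ :=
          ((cont_integral f hf).tendsto μ).mono_left nhdsWithin_le_nhds
            |>.eventually_lt_const (by linarith)
        refine ⟨_, e1.and e2, 0, fun b hb ν hν => ?_⟩
        obtain ⟨hν1, hν2⟩ := hν
        rw [hsplit]
        nlinarith [mul_nonneg hb (ha_nn ν)]
      · set α := ∫ x, a x ∂(μ : Measure X) with hα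
        have hα0 : 0 < α := lt_of_le_of_ne (ha_nn μ) (Ne.symm hμa)
        have e2 : ∀ᶠ ν : ProbabilityMeasure X in 𝓝[Minv Φ] μ,
            α / 2 < ∫ x, a x ∂(ν : Measure X) :=
          ((cont_integral a ha).tendsto μ).mono_left nhdsWithin_le_nhds
            |>.eventually_const_lt (by linarith)
        refine ⟨_, e2.and self_mem_nhdsWithin, max 0 ((C + F - c) / (α / 2)),
          fun b hb ν hν => ?_⟩
        obtain ⟨hν1, hν2⟩ := hν
        have hb0 : 0 ≤ b := (le_max_left _ _).trans hb
        have hb1 : (C + F - c) / (α / 2) ≤ b := (le_max_right _ _).trans hb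
        rw [div_le_iff₀ (by linarith)] at hb1
        rw [hsplit]
        nlinarith [mul_le_mul_of_nonneg_left hν1.le hb0, hub ν hν2]
  refine ⟨fun n => (n : ℝ) + 1, fun n => by positivity,
    tendsto_atTop_add_const_right _ _ tendsto_natCast_atTop_atTop, ?_⟩
  refine tendsto_order.2 ⟨fun c hc => ?_, fun c hc => ?_⟩
  · exact Eventually.of_forall fun n => hc.trans_le (hlow _ (by positivity))
  · obtain ⟨c', hc1, hc2⟩ := exists_between hc
    obtain ⟨B, hB⟩ := hup c' hc1
    filter_upwards [tendsto_natCast_atTop_atTop.eventually_ge_atTop B] with n hn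
    refine lt_of_le_of_lt (csSup_le ⟨_, μ₀, hμ₀, rfl⟩ ?_) hc2
    rintro r ⟨ν, hν, rfl⟩
    exact hB _ (by linarith) ν hν
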